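/- arXiv:1405.5853 — 3 statements merged into one kernel-verified Lean document; each statement's English description precedes it below -/
import Mathlib

section
/- Let Φ_C† : M_3(ℂ) → M_3(ℂ) be the dual of the Choi map. For every 9×9 complex matrix X indexed by Fin 3 × Fin 3 with ‖X‖_tr ≤ 1, one has ‖(id_3 ⊗ Φ_C†)(X)‖_tr ≤ 4/3. (Consequently the diamond norm of Φ_C† is at most 4/3.) -/
open Matrix BigOperators
open scoped ComplexOrder

noncomputable section

/-- The Choi map `Φ_C : M₃(ℂ) → M₃(ℂ)`. -/
def PhiC (X : Matrix (Fin 3) (Fin 3) ℂ) : Matrix (Fin 3) (Fin 3) ℂ :=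
  (1 / 2 : ℂ) •
    !![X 0 0 + X 1 1, -(X 0 1), -(X 0 2);
       -(X 1 0), X 1 1 + X 2 2, -(X 1 2);
       -(X 2 0), -(X 2 1), X 2 2 + X 0 0]

/-- The dual `Φ_C†` of the Choi map. -/
def PhiCdual (Y : Matrix (Fin 3) (Fin 3) ℂ) : Matrix (Fin 3) (Fin 3) ℂ :=
  (1 / 2 : ℂ) •
    !![Y 0 0 + Y 2 2, -(Y 0 1), -(Y 0 2);
       -(Y 1 0), Y 0 0 + Y 1 1, -(Y 1 2);
       -(Y 2 0), -(Y 2 1), Y 1 1 + Y 2 2]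

/-- The map `id_n ⊗ Φ`, acting blockwise on an `n² × n²` matrix indexed by
`Fin n × Fin n`. -/
def idTensor {n : ℕ} (Φ : Matrix (Fin n) (Fin n) ℂ → Matrix (Fin n) (Fin n) ℂ)
    (X : Matrix (Fin n × Fin n) (Fin n × Fin n) ℂ) :
    Matrix (Fin n × Fin n) (Fin n × Fin n) ℂ :=
  Matrix.of fun p q => Φ (Matrix.of fun k l => X (p.1, k) (q.1, l)) p.2 q.2

/-- The trace norm of a square complex matrix: the sum of its singular values. -/
def traceNorm {d : Type*} [Fintype d] [DecidableEq d] (X : Matrix d d ℂ) : ℝ :=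
  ∑ i, Real.sqrt ((Matrix.posSemidef_conjTranspose_mul_self X).1.eigenvalues i)

section TraceNorm

variable {d ι : Type*} [Fintype d] [Fintype ι]

theorem Matrix.re_trace_conjTranspose_mul_self_nonneg (A : Matrix d d ℂ) :
    0 ≤ (Aᴴ * A).trace.re :=
  (Complex.le_def.1 (Matrix.posSemidef_conjTranspose_mul_self A).trace_nonneg).1

theorem re_smul_trace_conjTranspose_mul_le (c : ℝ) (A B : Matrix d d ℂ) :
    c * (Aᴴ * B).trace.re ≤ |c| * (((Aᴴ * A).trace.re + (Bᴴ * B).trace.re) / 2) := by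
  have hsymm : (Bᴴ * A).trace.re = (Aᴴ * B).trace.re := by
    rw [← conjTranspose_conjTranspose A, ← conjTranspose_mul, trace_conjTranspose,
      conjTranspose_conjTranspose]
    simp
  have hsub := Matrix.re_trace_conjTranspose_mul_self_nonneg (A - B)
  have hadd := Matrix.re_trace_conjTranspose_mul_self_nonneg (A + B)
  simp only [conjTranspose_sub, conjTranspose_add, Matrix.sub_mul, Matrix.mul_sub, Matrix.add_mul,
    Matrix.mul_add, trace_sub, trace_add, Complex.sub_re, Complex.add_re] at hsub hadd
  calc c * (Aᴴ * B).trace.re ≤ |c| * |(Aᴴ * B).trace.re| := by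
        rw [← abs_mul]
        exact le_abs_self _
    _ ≤ _ := mul_le_mul_of_nonneg_left (abs_le.2 ⟨by linarith, by linarith⟩) (abs_nonneg c)

variable [DecidableEq d]

theorem exists_singular_value_decomposition (X : Matrix d d ℂ) :
    ∃ (U E : Matrix d d ℂ) (s : d → ℝ), (∀ i, 0 ≤ s i) ∧ Eᴴ * E = 1 ∧ E * Eᴴ = 1 ∧
      Uᴴ * U = diagonal (fun i => if s i = 0 then 0 else 1) ∧ U * (Uᴴ * U) = U ∧
      X = U * diagonal (fun i => (s i : ℂ)) * Eᴴ ∧ ∑ i, s i = traceNorm X := by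
  have hP := Matrix.posSemidef_conjTranspose_mul_self X
  set l : d → ℝ := hP.1.eigenvalues with hl
  set E : Matrix d d ℂ := (hP.1.eigenvectorUnitary : Matrix d d ℂ) with hE
  set s : d → ℝ := fun i => Real.sqrt (l i) with hs
  have hE₁ : Eᴴ * E = 1 := Unitary.coe_star_mul_self hP.1.eigenvectorUnitary
  have hE₂ : E * Eᴴ = 1 := Unitary.coe_mul_star_self hP.1.eigenvectorUnitary
  have hsl : ∀ i, (l i : ℂ) = s i * s i := fun i => by
    rw [← Complex.ofReal_mul, Real.mul_self_sqrt (hP.eigenvalues_nonneg i)]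
  have hspec : Xᴴ * X = E * diagonal (fun i => (l i : ℂ)) * Eᴴ := by
    have h := hP.1.spectral_theorem
    rw [Unitary.conjStarAlgAut_apply] at h
    exact h
  have hgram : (X * E)ᴴ * (X * E) = diagonal (fun i => (s i : ℂ) * s i) := by
    rw [conjTranspose_mul, show Eᴴ * Xᴴ * (X * E) = Eᴴ * (Xᴴ * X) * E by simp only [Matrix.mul_assoc],
      hspec, show Eᴴ * (E * diagonal (fun i => (l i : ℂ)) * Eᴴ) * E =
        (Eᴴ * E) * diagonal (fun i => (l i : ℂ)) * (Eᴴ * E) by simp only [Matrix.mul_assoc], hE₁]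
    simp [hsl]
  have hdiag : ∀ f : d → ℝ, (diagonal (fun i => (f i : ℂ)))ᴴ = diagonal (fun i => (f i : ℂ)) :=
    fun f => by
      rw [diagonal_conjTranspose]
      congr 1
      ext i
      simp
  have hcompr : ∀ f : d → ℝ, (X * E * diagonal (fun i => (f i : ℂ)))ᴴ *
      (X * E * diagonal (fun i => (f i : ℂ))) =
        diagonal (fun i => ((f i * (s i * s i) * f i : ℝ) : ℂ)) := fun f => by
    rw [conjTranspose_mul, Matrix.mul_assoc, ← Matrix.mul_assoc (X * E)ᴴ, hgram, hdiag]
    simp [mul_assoc]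
  have hker : X * E * diagonal (fun i => ((if s i = 0 then 0 else 1 : ℝ) : ℂ)) = X * E := by
    have h : X * E * diagonal (fun i => ((1 - (if s i = 0 then 0 else 1) : ℝ) : ℂ)) = 0 := by
      rw [← Matrix.conjTranspose_mul_self_eq_zero, hcompr, ← diagonal_zero]
      congr 1
      ext i
      by_cases h : s i = 0 <;> simp [h]
    have h₂ : diagonal (fun i => ((1 - (if s i = 0 then 0 else 1) : ℝ) : ℂ)) =
        1 - diagonal (fun i => ((if s i = 0 then 0 else 1 : ℝ) : ℂ)) := by
      rw [← diagonal_one, diagonal_sub]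
      simp
    rw [h₂, Matrix.mul_sub, Matrix.mul_one, sub_eq_zero] at h
    exact h.symm
  have hUU : (X * E * diagonal (fun i => ((s i)⁻¹ : ℝ) : d → ℂ))ᴴ *
      (X * E * diagonal (fun i => ((s i)⁻¹ : ℝ) : d → ℂ)) =
        diagonal (fun i => if s i = 0 then 0 else 1) := by
    rw [hcompr]
    congr 1
    ext i
    by_cases h : s i = 0
    · simp [h]
    · simp [h]
  refine ⟨X * E * diagonal (fun i => ((s i)⁻¹ : ℝ) : d → ℂ), E, s, fun i => Real.sqrt_nonneg _,
    hE₁, hE₂, hUU, ?_, ?_, rfl⟩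
  · rw [hUU, Matrix.mul_assoc, diagonal_mul_diagonal]
    congr 2
    ext i
    by_cases h : s i = 0 <;> simp [h]
  · rw [Matrix.mul_assoc (X * E), diagonal_mul_diagonal]
    have h : (fun i => (((s i)⁻¹ : ℝ) : ℂ) * (s i : ℂ)) =
        fun i => ((if s i = 0 then 0 else 1 : ℝ) : ℂ) := by
      ext i
      by_cases h : s i = 0 <;> simp [h]
    rw [h, hker, Matrix.mul_assoc, hE₂, Matrix.mul_one]

theorem exists_balanced_factorization (X : Matrix d d ℂ) :
    ∃ A B : Matrix d d ℂ, X = A * Bᴴ ∧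
      (Aᴴ * A).trace.re = traceNorm X ∧ (Bᴴ * B).trace.re = traceNorm X := by
  obtain ⟨U, E, s, hs, hE, -, hU, -, hX, htr⟩ := exists_singular_value_decomposition X
  set T : Matrix d d ℂ := diagonal (fun i => (Real.sqrt (s i) : ℂ)) with hT
  have hTT : T * T = diagonal (fun i => (s i : ℂ)) := by
    rw [hT, diagonal_mul_diagonal]
    congr 1
    ext i
    rw [← Complex.ofReal_mul, Real.mul_self_sqrt (hs i)]
  have hTc : Tᴴ = T := by
    rw [hT, diagonal_conjTranspose]
    congr 1
    ext i
    simp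
  have hUT : Uᴴ * U * T = T := by
    rw [hU, hT, diagonal_mul_diagonal]
    congr 1
    ext i
    by_cases h : s i = 0 <;> simp [h]
  have htrT : (T * T).trace.re = traceNorm X := by
    rw [hTT, trace_diagonal, ← htr]
    simp
  refine ⟨U * T, E * T, ?_, ?_, ?_⟩
  · rw [conjTranspose_mul, hTc, hX, ← hTT]
    simp only [Matrix.mul_assoc]
  · rw [conjTranspose_mul, hTc, Matrix.mul_assoc, ← Matrix.mul_assoc Uᴴ, hUT, htrT]
  · rw [conjTranspose_mul, hTc, Matrix.mul_assoc, ← Matrix.mul_assoc Eᴴ, hE, Matrix.one_mul, htrT]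

theorem traceNorm_sum_smul_mul_conjTranspose_le (c : ι → ℝ) (A B : ι → Matrix d d ℂ) :
    traceNorm (∑ a, (c a : ℂ) • (A a * (B a)ᴴ)) ≤
      ∑ a, |c a| * ((((A a)ᴴ * A a).trace.re + ((B a)ᴴ * B a).trace.re) / 2) := by
  obtain ⟨U, E, s, -, hE, hE', hU, hUU, hX, htr⟩ :=
    exists_singular_value_decomposition (∑ a, (c a : ℂ) • (A a * (B a)ᴴ))
  have hdual : traceNorm (∑ a, (c a : ℂ) • (A a * (B a)ᴴ)) =
      (E * Uᴴ * ∑ a, (c a : ℂ) • (A a * (B a)ᴴ)).trace.re := by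
    rw [← htr]
    conv_rhs => rw [hX]
    rw [show E * Uᴴ * (U * diagonal (fun i => (s i : ℂ)) * Eᴴ) =
      E * (Uᴴ * U * diagonal (fun i => (s i : ℂ)) * Eᴴ) by simp only [Matrix.mul_assoc],
      trace_mul_comm, Matrix.mul_assoc, hE, Matrix.mul_one, hU, diagonal_mul_diagonal,
      trace_diagonal, Complex.re_sum]
    refine Finset.sum_congr rfl fun i _ => ?_
    by_cases h : s i = 0 <;> simp [h]
  have hcontr : ∀ W : Matrix d d ℂ,
      ((Uᴴ * W)ᴴ * (Uᴴ * W)).trace.re ≤ (Wᴴ * W).trace.re := fun W => by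
    have h := Matrix.re_trace_conjTranspose_mul_self_nonneg (W - U * (Uᴴ * W))
    have hproj : (W - U * (Uᴴ * W))ᴴ * (W - U * (Uᴴ * W)) =
        Wᴴ * W - (Uᴴ * W)ᴴ * (Uᴴ * W) := by
      have h₁ : (Uᴴ * W)ᴴ * Uᴴ * (U * (Uᴴ * W)) = (Uᴴ * W)ᴴ * (Uᴴ * W) := by
        rw [show (Uᴴ * W)ᴴ * Uᴴ * (U * (Uᴴ * W)) = Wᴴ * (U * (Uᴴ * U)) * (Uᴴ * W) by
          simp only [conjTranspose_mul, conjTranspose_conjTranspose, Matrix.mul_assoc], hUU]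
        simp only [conjTranspose_mul, conjTranspose_conjTranspose]
      have h₂ : Wᴴ * (U * (Uᴴ * W)) = (Uᴴ * W)ᴴ * (Uᴴ * W) := by
        simp only [conjTranspose_mul, conjTranspose_conjTranspose, Matrix.mul_assoc]
      rw [conjTranspose_sub, conjTranspose_mul U, Matrix.sub_mul, Matrix.mul_sub, Matrix.mul_sub,
        h₁, h₂, Matrix.mul_assoc _ Uᴴ W]
      abel
    rw [hproj, trace_sub, Complex.sub_re] at h
    linarith
  have hterm : ∀ W V : Matrix d d ℂ,
      (E * Uᴴ * (W * Vᴴ)).trace = ((Eᴴ * V)ᴴ * (Uᴴ * W)).trace := fun W V => by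
    rw [← Matrix.mul_assoc, trace_mul_comm, conjTranspose_mul, conjTranspose_conjTranspose]
    simp only [Matrix.mul_assoc]
  have hunit : ∀ V : Matrix d d ℂ, (Eᴴ * V)ᴴ * (Eᴴ * V) = Vᴴ * V := fun V => by
    rw [conjTranspose_mul, conjTranspose_conjTranspose, Matrix.mul_assoc, ← Matrix.mul_assoc E,
      hE', Matrix.one_mul]
  rw [hdual, Matrix.mul_sum, trace_sum, Complex.re_sum]
  refine Finset.sum_le_sum fun a _ => ?_
  rw [Matrix.mul_smul, trace_smul, smul_eq_mul, Complex.re_ofReal_mul, hterm]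
  refine (re_smul_trace_conjTranspose_mul_le _ _ _).trans ?_
  rw [hunit]
  exact mul_le_mul_of_nonneg_left (by linarith [hcontr (A a)]) (abs_nonneg _)

/-- A signed Kraus decomposition whose absolute value is `r` times a trace-preserving map
bounds the trace norm by `r`. -/
theorem traceNorm_signed_kraus_le (c : ι → ℝ) (K : ι → Matrix d d ℂ) (r : ℝ)
    (hK : ∑ a, ((|c a| : ℝ) : ℂ) • ((K a)ᴴ * K a) = (r : ℂ) • 1) (X : Matrix d d ℂ) :
    traceNorm (∑ a, (c a : ℂ) • (K a * X * (K a)ᴴ)) ≤ r * traceNorm X := by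
  obtain ⟨A, B, hX, hA, hB⟩ := exists_balanced_factorization X
  have htr : ∀ W : Matrix d d ℂ,
      ∑ a, |c a| * ((K a * W)ᴴ * (K a * W)).trace.re = r * (Wᴴ * W).trace.re := fun W => by
    have h : (Wᴴ * (∑ a, ((|c a| : ℝ) : ℂ) • ((K a)ᴴ * K a)) * W).trace.re =
        r * (Wᴴ * W).trace.re := by
      rw [hK]
      simp
    rw [← h, Matrix.mul_sum, Matrix.sum_mul, trace_sum, Complex.re_sum]
    refine Finset.sum_congr rfl fun a _ => ?_
    rw [Matrix.mul_smul, Matrix.smul_mul, trace_smul, smul_eq_mul, Complex.re_ofReal_mul]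
    simp only [conjTranspose_mul, Matrix.mul_assoc]
  have hfac : ∑ a, (c a : ℂ) • (K a * X * (K a)ᴴ) =
      ∑ a, (c a : ℂ) • (K a * A * (K a * B)ᴴ) := by
    simp only [hX, conjTranspose_mul, Matrix.mul_assoc]
  rw [hfac]
  refine (traceNorm_sum_smul_mul_conjTranspose_le c _ _).trans (le_of_eq ?_)
  simp only [mul_div_assoc', mul_add, ← Finset.sum_div, Finset.sum_add_distrib, htr, hA, hB]
  ring

end TraceNorm

theorem idTensor_apply_eq_sum_kronecker {n : ℕ} {ι : Type*} [Fintype ι]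
    (Φ : Matrix (Fin n) (Fin n) ℂ → Matrix (Fin n) (Fin n) ℂ) (c : ι → ℝ)
    (K : ι → Matrix (Fin n) (Fin n) ℂ)
    (hΦ : ∀ Y, Φ Y = ∑ a, (c a : ℂ) • (K a * Y * (K a)ᴴ))
    (X : Matrix (Fin n × Fin n) (Fin n × Fin n) ℂ) :
    idTensor Φ X = ∑ a, (c a : ℂ) •
      (kroneckerMap (· * ·) 1 (K a) * X * (kroneckerMap (· * ·) 1 (K a))ᴴ) := by
  ext ⟨i, k⟩ ⟨j, l⟩
  simp [idTensor, hΦ, Matrix.sum_apply, Matrix.mul_apply, Fintype.sum_prod_type,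
    kroneckerMap_apply, Matrix.one_apply, ite_mul, apply_ite]

/-- The signs and weights of the Kraus operators of `Φ_C†`. -/
def choiDualWeight : Fin 7 → ℝ := ![1, 1, 1, 1 / 2, 1 / 2, 1 / 2, -(1 / 6)]

/-- The Kraus operators of `Φ_C†`: diagonal ones spanning the complement of the identity, the
three cyclic matrix units, and the identity. -/
def choiDualKraus : Fin 7 → Matrix (Fin 3) (Fin 3) ℂ :=
  ![!![2 / 3, 0, 0; 0, -(1 / 3), 0; 0, 0, -(1 / 3)],
    !![-(1 / 3), 0, 0; 0, 2 / 3, 0; 0, 0, -(1 / 3)],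
    !![-(1 / 3), 0, 0; 0, -(1 / 3), 0; 0, 0, 2 / 3],
    !![0, 0, 1; 0, 0, 0; 0, 0, 0],
    !![0, 0, 0; 1, 0, 0; 0, 0, 0],
    !![0, 0, 0; 0, 0, 0; 0, 1, 0],
    !![1, 0, 0; 0, 1, 0; 0, 0, 1]]

theorem PhiCdual_eq_sum_kraus (Y : Matrix (Fin 3) (Fin 3) ℂ) :
    PhiCdual Y = ∑ a, (choiDualWeight a : ℂ) • (choiDualKraus a * Y * (choiDualKraus a)ᴴ) := by
  ext i j
  fin_cases i <;> fin_cases j <;>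
    simp [PhiCdual, choiDualWeight, choiDualKraus, Fin.sum_univ_succ, Matrix.mul_apply,
      Matrix.vecMul,
      Matrix.vecHead, Matrix.vecTail, Complex.conj_ofNat] <;> ring

theorem sum_abs_choiDualWeight_smul :
    ∑ a, ((|choiDualWeight a| : ℝ) : ℂ) • ((choiDualKraus a)ᴴ * choiDualKraus a) =
      ((4 / 3 : ℝ) : ℂ) • 1 := by
  ext i j
  fin_cases i <;> fin_cases j <;>
    simp [choiDualWeight, choiDualKraus, Fin.sum_univ_succ, Matrix.mul_apply, Complex.conj_ofNat] <;>
    norm_num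

/-- The diamond norm of `Φ_C†` is at most `4/3`: applying `id₃ ⊗ Φ_C†` to any matrix of
trace norm at most one yields a matrix of trace norm at most `4/3`. -/
theorem diamond_norm_PhiCdual_le (X : Matrix (Fin 3 × Fin 3) (Fin 3 × Fin 3) ℂ)
    (hX : traceNorm X ≤ 1) :
    traceNorm (idTensor PhiCdual X) ≤ 4 / 3 := by
  rw [idTensor_apply_eq_sum_kronecker PhiCdual choiDualWeight choiDualKraus PhiCdual_eq_sum_kraus]
  refine (traceNorm_signed_kraus_le choiDualWeight _ (4 / 3) ?_ X).trans (by linarith)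
  have h : ∀ a, (kroneckerMap (· * ·) (1 : Matrix (Fin 3) (Fin 3) ℂ) (choiDualKraus a))ᴴ *
      kroneckerMap (· * ·) (1 : Matrix (Fin 3) (Fin 3) ℂ) (choiDualKraus a) =
      kroneckerMap (· * ·) 1 ((choiDualKraus a)ᴴ * choiDualKraus a) := fun a => by
    rw [conjTranspose_kronecker, ← mul_kronecker_mul]
    simp
  simp_rw [h, ← kronecker_smul]
  rw [← one_kronecker_one, ← kronecker_smul, ← sum_abs_choiDualWeight_smul]
  ext ⟨i, k⟩ ⟨j, l⟩
  simp [Matrix.sum_apply, Finset.mul_sum]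

end
end

section
/- Let v ∈ ℂ³ ⊗ ℂ³ be a unit vector and let v v† denote the corresponding rank-one projection, a 9×9 matrix indexed by Fin 3 × Fin 3. Then every eigenvalue of the Hermitian matrix (id_3 ⊗ Φ_C†)(v v†) lies in the interval [−1/6, 2/3], where Φ_C† is the dual of the Choi map. -/
open Matrix BigOperators
open scoped ComplexOrder

noncomputable section

lemma sq_add_le_mul_add {x y a b c d : ℝ} (ha : 0 ≤ a) (hb : 0 ≤ b) (hc : 0 ≤ c) (hd : 0 ≤ d)
    (hx : x ^ 2 ≤ a * b) (hy : y ^ 2 ≤ c * d) : (x + y) ^ 2 ≤ (a + c) * (b + d) := by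
  have h : 2 * (x * y) ≤ a * d + c * b := by
    apply le_of_sq_le_sq _ (by positivity)
    nlinarith [mul_le_mul hx hy (sq_nonneg y) (by positivity), sq_nonneg (a * d - c * b)]
  nlinarith

lemma sq_add_add_le_mul_add_add {x y z a b c d e f : ℝ} (ha : 0 ≤ a) (hb : 0 ≤ b) (hc : 0 ≤ c)
    (hd : 0 ≤ d) (he : 0 ≤ e) (hf : 0 ≤ f) (hx : x ^ 2 ≤ a * b) (hy : y ^ 2 ≤ c * d)
    (hz : z ^ 2 ≤ e * f) : (x + y + z) ^ 2 ≤ (a + c + e) * (b + d + f) :=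
  sq_add_le_mul_add (by positivity) (by positivity) he hf (sq_add_le_mul_add ha hb hc hd hx hy) hz

lemma mul_cubic_le_of_lt {a b c : ℝ} (ha : 0 ≤ a) (hb : 0 ≤ b) (hc : 0 ≤ c) (h : a + b + c = 1)
    (hd : 1 / 3 + b < a) :
    (a - b - 1 / 3) * ((1 / 3 - b + c) * (1 / 3 - c + a) + b * (1 / 3 - c + a)
      + c * (1 / 3 - b + c)) ≤ a * ((1 / 3 - b + c) * (1 / 3 - c + a)) := by
  obtain rfl : a = 1 - b - c := by linarith
  have h2 : 2 * b + c < 2 / 3 := by linarith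
  have h3 := sub_nonneg.2 h2.le
  nlinarith [mul_nonneg hb hc, mul_nonneg hb h3, mul_nonneg hc h3,
    mul_nonneg (mul_nonneg hb hc) h3, mul_nonneg hb (sq_nonneg (b - 1 / 3)),
    mul_nonneg hc (sq_nonneg (b - 1 / 3)), sq_nonneg (b - 1 / 3)]

/-- The case of `two_mul_sum_sq_le` where the coefficient `4 / 3 - p₂ - 2 * p₀` is negative. -/
lemma two_mul_sum_sq_le_of_lt {p₀ p₁ p₂ q₀ q₁ q₂ : ℝ} {t₀ t₁ t₂ : ℂ}
    (hp₀ : 0 ≤ p₀) (hp₁ : 0 ≤ p₁) (hp₂ : 0 ≤ p₂) (hp : p₀ + p₁ + p₂ = 1)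
    (hq₁ : 0 ≤ q₁) (hq₂ : 0 ≤ q₂)
    (h₀ : ‖t₀‖ ^ 2 ≤ p₀ * q₀) (h₁ : ‖t₁‖ ^ 2 ≤ p₁ * q₁) (h₂ : ‖t₂‖ ^ 2 ≤ p₂ * q₂)
    (hd : 1 / 3 + p₁ < p₀) :
    2 * (‖t₀‖ ^ 2 + ‖t₁‖ ^ 2 + ‖t₂‖ ^ 2) ≤
      (4 / 3 - p₂) * q₀ + (4 / 3 - p₀) * q₁ + (4 / 3 - p₁) * q₂ + ‖t₀ + t₁ + t₂‖ ^ 2 := by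
  have hp₀' : 0 < p₀ := by linarith
  have hd₁ : 0 < 1 / 3 - p₁ + p₂ := by linarith
  have hd₂ : 0 < 1 / 3 - p₂ + p₀ := by linarith
  have hcub := mul_cubic_le_of_lt hp₀ hp₁ hp₂ hp hd
  set d₁ := 1 / 3 - p₁ + p₂ with hd₁_def
  set d₂ := 1 / 3 - p₂ + p₀ with hd₂_def
  have htri : ‖t₀‖ ≤ ‖t₀ + t₁ + t₂‖ + ‖t₁‖ + ‖t₂‖ := by
    calc ‖t₀‖ = ‖(t₀ + t₁ + t₂) - t₁ - t₂‖ := by ring_nf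
      _ ≤ ‖(t₀ + t₁ + t₂) - t₁‖ + ‖t₂‖ := norm_sub_le _ _
      _ ≤ _ := by gcongr; exact norm_sub_le _ _
  have hcs : ‖t₀‖ ^ 2 ≤ (1 + p₁ / d₁ + p₂ / d₂) * (‖t₀ + t₁ + t₂‖ ^ 2 + d₁ * q₁ + d₂ * q₂) :=
    (pow_le_pow_left₀ (norm_nonneg _) htri 2).trans <|
      sq_add_add_le_mul_add_add zero_le_one (by positivity) (by positivity) (by positivity)
        (by positivity) (by positivity) (by simp) (h₁.trans_eq (by field_simp))
        (h₂.trans_eq (by field_simp))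
  have hm : (p₀ - p₁ - 1 / 3) * (1 + p₁ / d₁ + p₂ / d₂) ≤ p₀ := by
    have : 1 + p₁ / d₁ + p₂ / d₂ = (d₁ * d₂ + p₁ * d₂ + p₂ * d₁) / (d₁ * d₂) := by field_simp
    rw [this, ← mul_div_assoc, div_le_iff₀ (by positivity)]
    exact hcub
  have hmul : (p₀ - p₁ - 1 / 3) * ‖t₀‖ ^ 2 ≤
      p₀ * (‖t₀ + t₁ + t₂‖ ^ 2 + d₁ * q₁ + d₂ * q₂) :=
    calc _ ≤ (p₀ - p₁ - 1 / 3) * ((1 + p₁ / d₁ + p₂ / d₂) *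
          (‖t₀ + t₁ + t₂‖ ^ 2 + d₁ * q₁ + d₂ * q₂)) :=
          mul_le_mul_of_nonneg_left hcs (by linarith)
      _ ≤ _ := by
          rw [← mul_assoc]
          exact mul_le_mul_of_nonneg_right hm (by positivity)
  have hq₀ := mul_le_mul_of_nonneg_left h₀ (show 0 ≤ 4 / 3 - p₂ by linarith)
  have hfin : 2 * ‖t₀‖ ^ 2 ≤
      (4 / 3 - p₂) * q₀ + (‖t₀ + t₁ + t₂‖ ^ 2 + d₁ * q₁ + d₂ * q₂) := by
    refine le_of_mul_le_mul_left ?_ hp₀'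
    obtain rfl : p₂ = 1 - p₀ - p₁ := by linarith
    linarith
  have e₁ : d₁ = 4 / 3 - p₀ - 2 * p₁ := by linarith
  have e₂ : d₂ = 4 / 3 - p₁ - 2 * p₂ := by linarith
  rw [e₁, e₂] at hfin
  linarith

lemma two_mul_sum_sq_le {p₀ p₁ p₂ q₀ q₁ q₂ : ℝ} {t₀ t₁ t₂ : ℂ}
    (hp₀ : 0 ≤ p₀) (hp₁ : 0 ≤ p₁) (hp₂ : 0 ≤ p₂) (hp : p₀ + p₁ + p₂ = 1)
    (hq₀ : 0 ≤ q₀) (hq₁ : 0 ≤ q₁) (hq₂ : 0 ≤ q₂)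
    (h₀ : ‖t₀‖ ^ 2 ≤ p₀ * q₀) (h₁ : ‖t₁‖ ^ 2 ≤ p₁ * q₁) (h₂ : ‖t₂‖ ^ 2 ≤ p₂ * q₂) :
    2 * (‖t₀‖ ^ 2 + ‖t₁‖ ^ 2 + ‖t₂‖ ^ 2) ≤
      (4 / 3 - p₂) * q₀ + (4 / 3 - p₀) * q₁ + (4 / 3 - p₁) * q₂ + ‖t₀ + t₁ + t₂‖ ^ 2 := by
  rcases lt_or_ge (1 / 3 + p₁) p₀ with hd₀ | hd₀
  · exact two_mul_sum_sq_le_of_lt hp₀ hp₁ hp₂ hp hq₁ hq₂ h₀ h₁ h₂ hd₀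
  rcases lt_or_ge (1 / 3 + p₂) p₁ with hd₁ | hd₁
  · have := two_mul_sum_sq_le_of_lt hp₁ hp₂ hp₀ (by linarith) hq₂ hq₀ h₁ h₂ h₀ hd₁
    rw [show t₁ + t₂ + t₀ = t₀ + t₁ + t₂ by ring] at this
    linarith
  rcases lt_or_ge (1 / 3 + p₀) p₂ with hd₂ | hd₂
  · have := two_mul_sum_sq_le_of_lt hp₂ hp₀ hp₁ (by linarith) hq₀ hq₁ h₂ h₀ h₁ hd₂
    rw [show t₂ + t₀ + t₁ = t₀ + t₁ + t₂ by ring] at this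
    linarith
  have k₀ := mul_nonneg (show 0 ≤ 4 / 3 - p₂ - 2 * p₀ by linarith) hq₀
  have k₁ := mul_nonneg (show 0 ≤ 4 / 3 - p₀ - 2 * p₁ by linarith) hq₁
  have k₂ := mul_nonneg (show 0 ≤ 4 / 3 - p₁ - 2 * p₂ by linarith) hq₂
  linarith [sq_nonneg ‖t₀ + t₁ + t₂‖]

lemma norm_sum_star_mul_sq_le {ι : Type*} (s : Finset ι) (f g : ι → ℂ) :
    ‖∑ i ∈ s, star (f i) * g i‖ ^ 2 ≤ (∑ i ∈ s, ‖g i‖ ^ 2) * ∑ i ∈ s, ‖f i‖ ^ 2 := by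
  rw [mul_comm]
  refine le_trans ?_ (Finset.sum_mul_sq_le_sq_mul_sq s (fun i => ‖f i‖) fun i => ‖g i‖)
  gcongr
  exact (norm_sum_le _ _).trans_eq (by simp)

/-- The pairing of the `k`-th column of `w` with the `l`-th column of `v`. -/
def columnPairing (w v : Fin 3 × Fin 3 → ℂ) (k l : Fin 3) : ℂ :=
  ∑ i, star (w (i, k)) * v (i, l)

lemma dotProduct_idTensor_PhiCdual_mulVec (v w : Fin 3 × Fin 3 → ℂ) :
    star w ⬝ᵥ idTensor PhiCdual (vecMulVec v (star v)) *ᵥ w =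
      ((1 / 2 * (2 * (‖columnPairing w v 0 0‖ ^ 2 + ‖columnPairing w v 1 1‖ ^ 2
        + ‖columnPairing w v 2 2‖ ^ 2)
        - ‖columnPairing w v 0 0 + columnPairing w v 1 1 + columnPairing w v 2 2‖ ^ 2
        + (‖columnPairing w v 0 2‖ ^ 2 + ‖columnPairing w v 1 0‖ ^ 2
          + ‖columnPairing w v 2 1‖ ^ 2)) : ℝ) : ℂ) := by
  push_cast
  simp only [← Complex.mul_conj']
  simp only [columnPairing, dotProduct, mulVec, idTensor, PhiCdual, vecMulVec,
    Fintype.sum_prod_type, Fin.sum_univ_three, Matrix.of_apply, Pi.star_apply, Matrix.smul_apply,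
    smul_eq_mul, map_add, map_mul, RCLike.star_def, Complex.conj_conj, Matrix.cons_val',
    Matrix.cons_val_zero, Matrix.cons_val_one, Matrix.cons_val]
  ring

lemma sum_norm_sq_columns (w : Fin 3 × Fin 3 → ℂ) :
    (∑ i, ‖w (i, 0)‖ ^ 2) + (∑ i, ‖w (i, 1)‖ ^ 2) + ∑ i, ‖w (i, 2)‖ ^ 2 = ∑ p, ‖w p‖ ^ 2 := by
  rw [Fintype.sum_prod_type_right, Fin.sum_univ_three (fun k => ∑ i, ‖w (i, k)‖ ^ 2)]

/-- For a unit vector `v ∈ ℂ³ ⊗ ℂ³`, the eigenvalues of `(id₃ ⊗ Φ_C†)(v v†)` lie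
in the interval `[-1/6, 2/3]`. -/
theorem eigenvalues_idTensor_PhiCdual_mem_Icc (v : Fin 3 × Fin 3 → ℂ)
    (hv : (∑ p, star (v p) * v p) = (1 : ℂ))
    (h : (idTensor PhiCdual (Matrix.vecMulVec v (star v))).IsHermitian) :
    ∀ i, h.eigenvalues i ∈ Set.Icc (-(1 / 6) : ℝ) (2 / 3) := by
  intro i
  have hv' : ∑ p, ‖v p‖ ^ 2 = 1 := by
    have : ((∑ p, ‖v p‖ ^ 2 : ℝ) : ℂ) = 1 := by
      rw [← hv]
      push_cast
      exact Finset.sum_congr rfl fun p _ => (Complex.conj_mul' _).symm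
    exact_mod_cast this
  have hw : ∑ p, ‖h.eigenvectorBasis i p‖ ^ 2 = 1 := by
    rw [← EuclideanSpace.norm_sq_eq, h.eigenvectorBasis.norm_eq_one, one_pow]
  rw [h.eigenvalues_eq, dotProduct_idTensor_PhiCdual_mulVec]
  generalize WithLp.ofLp (h.eigenvectorBasis i) = w at hw ⊢
  rw [← sum_norm_sq_columns] at hv' hw
  have hcs (k l : Fin 3) : ‖columnPairing w v k l‖ ^ 2 ≤
      (∑ i, ‖v (i, l)‖ ^ 2) * ∑ i, ‖w (i, k)‖ ^ 2 :=
    norm_sum_star_mul_sq_le _ _ _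
  have hnn (u : Fin 3 × Fin 3 → ℂ) (k : Fin 3) : 0 ≤ ∑ i, ‖u (i, k)‖ ^ 2 := by positivity
  have hup := two_mul_sum_sq_le (hnn v 0) (hnn v 1) (hnn v 2) hv' (hnn w 0) (hnn w 1) (hnn w 2)
    (hcs 0 0) (hcs 1 1) (hcs 2 2)
  have htri := norm_add₃_le (a := columnPairing w v 0 0) (b := columnPairing w v 1 1)
    (c := columnPairing w v 2 2)
  have hsq := pow_le_pow_left₀ (norm_nonneg _) htri 2
  have hone := sq_add_add_le_mul_add_add (hnn v 0) (hnn w 0) (hnn v 1) (hnn w 1) (hnn v 2)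
    (hnn w 2) (hcs 0 0) (hcs 1 1) (hcs 2 2)
  rw [hv', hw] at hone
  rw [RCLike.re_to_complex, Complex.ofReal_re]
  constructor
  · nlinarith [sq_nonneg (‖columnPairing w v 0 0‖ - ‖columnPairing w v 1 1‖),
      sq_nonneg (‖columnPairing w v 1 1‖ - ‖columnPairing w v 2 2‖),
      sq_nonneg (‖columnPairing w v 0 0‖ - ‖columnPairing w v 2 2‖),
      sq_nonneg ‖columnPairing w v 0 2‖, sq_nonneg ‖columnPairing w v 1 0‖,
      sq_nonneg ‖columnPairing w v 2 1‖]
  · linarith [hcs 0 2, hcs 1 0, hcs 2 1]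

end
end

section
/- Let b, c ≥ 0 be real numbers with b + c ≤ 3. For every 9×9 complex matrix X indexed by Fin 3 × Fin 3 with ‖X‖_tr ≤ 1, one has ‖(id_3 ⊗ Φ_{b,c}†)(X)‖_tr ≤ (3 + b + c)/3, where Φ_{b,c}† = Φ_{c,b} is the dual of the generalized Choi map. (Consequently the diamond norm of Φ_{b,c}† is at most (3+b+c)/3.) -/
open Matrix BigOperators
open scoped ComplexOrder

noncomputable section

/-- The generalized Choi map `Φ_{b,c} : M₃(ℂ) → M₃(ℂ)` (with `a = 2 - b - c`). -/
def PhiG (b c : ℝ) (X : Matrix (Fin 3) (Fin 3) ℂ) : Matrix (Fin 3) (Fin 3) ℂ :=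
  (1 / 2 : ℂ) •
    !![((2 - b - c : ℝ) : ℂ) * X 0 0 + (b : ℂ) * X 1 1 + (c : ℂ) * X 2 2,
         -(X 0 1), -(X 0 2);
       -(X 1 0),
         (c : ℂ) * X 0 0 + ((2 - b - c : ℝ) : ℂ) * X 1 1 + (b : ℂ) * X 2 2,
         -(X 1 2);
       -(X 2 0), -(X 2 1),
         (b : ℂ) * X 0 0 + (c : ℂ) * X 1 1 + ((2 - b - c : ℝ) : ℂ) * X 2 2]

section TraceNorm

variable {d : Type*} [Fintype d]

lemma norm_dotProduct_le (u v : d → ℂ) :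
    ‖u ⬝ᵥ v‖ ≤ Real.sqrt (∑ j, ‖u j‖ ^ 2) * Real.sqrt (∑ j, ‖v j‖ ^ 2) := by
  calc ‖∑ j, u j * v j‖ ≤ ∑ j, ‖u j‖ * ‖v j‖ := by
        refine (norm_sum_le _ _).trans_eq (Finset.sum_congr rfl fun j _ => norm_mul _ _)
    _ ≤ _ := Real.sum_mul_le_sqrt_mul_sqrt _ _ _

lemma mul_conjTranspose_apply_self (A : Matrix d d ℂ) (i : d) :
    (A * Aᴴ) i i = ((∑ j, ‖A i j‖ ^ 2 : ℝ) : ℂ) := by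
  simp [Matrix.mul_apply, Complex.mul_conj, Complex.normSq_eq_norm_sq]

lemma conjTranspose_mul_apply_self (B : Matrix d d ℂ) (i : d) :
    (Bᴴ * B) i i = ((∑ j, ‖B j i‖ ^ 2 : ℝ) : ℂ) := by
  simpa using mul_conjTranspose_apply_self Bᴴ i

variable [DecidableEq d]

lemma conjTranspose_eigenvectorUnitary_mul_mul {H : Matrix d d ℂ} (hH : H.IsHermitian) :
    (hH.eigenvectorUnitary : Matrix d d ℂ)ᴴ * H * (hH.eigenvectorUnitary : Matrix d d ℂ) =
      diagonal (fun i => (hH.eigenvalues i : ℂ)) := by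
  have h := hH.conjStarAlgAut_star_eigenvectorUnitary
  rw [Unitary.conjStarAlgAut_star_apply] at h
  exact h

/-- A contraction pairs with `X` to at most the trace norm of `X`. -/
lemma norm_trace_mul_le_traceNorm (X : Matrix d d ℂ) {W : Matrix d d ℂ}
    (hW : (1 - W * Wᴴ).PosSemidef) : ‖(W * X).trace‖ ≤ traceNorm X := by
  set hH := (Matrix.posSemidef_conjTranspose_mul_self X).1
  set U : Matrix d d ℂ := hH.eigenvectorUnitary.1 with hU
  have hUU : U * Uᴴ = 1 := Unitary.coe_mul_star_self hH.eigenvectorUnitary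
  have hUU' : Uᴴ * U = 1 := Unitary.coe_star_mul_self hH.eigenvectorUnitary
  have htr : (W * X).trace = ∑ i, (Uᴴ * W) i ⬝ᵥ fun j => (X * U) j i := by
    have : (W * X).trace = ((Uᴴ * W) * (X * U)).trace := by
      rw [Matrix.trace_mul_comm (Uᴴ * W), Matrix.mul_assoc X, ← Matrix.mul_assoc U, hUU,
        Matrix.one_mul, Matrix.trace_mul_comm]
    rw [this]
    rfl
  rw [htr, traceNorm]
  refine (norm_sum_le _ _).trans (Finset.sum_le_sum fun i _ => ?_)
  have hA : ∑ j, ‖(Uᴴ * W) i j‖ ^ 2 ≤ 1 := by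
    have h := (hW.conjTranspose_mul_mul_same U).diag_nonneg (i := i)
    have h' : Uᴴ * (1 - W * Wᴴ) * U = 1 - (Uᴴ * W) * (Uᴴ * W)ᴴ := by
      simp only [conjTranspose_mul, conjTranspose_conjTranspose, Matrix.mul_sub, Matrix.sub_mul,
        Matrix.mul_one, hUU', Matrix.mul_assoc]
    rw [h', Matrix.sub_apply, mul_conjTranspose_apply_self, Matrix.one_apply_eq] at h
    have h2 : (0 : ℝ) ≤ 1 - ∑ j, ‖(Uᴴ * W) i j‖ ^ 2 := by exact_mod_cast h
    linarith
  have hB : ∑ j, ‖(X * U) j i‖ ^ 2 = hH.eigenvalues i := by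
    have h := congrFun (congrFun (conjTranspose_eigenvectorUnitary_mul_mul hH) i) i
    rw [← hU, diagonal_apply_eq] at h
    have h' : Uᴴ * (Xᴴ * X) * U = (X * U)ᴴ * (X * U) := by
      simp only [conjTranspose_mul, Matrix.mul_assoc]
    rw [h', conjTranspose_mul_apply_self] at h
    exact_mod_cast h
  refine (norm_dotProduct_le _ _).trans ?_
  rw [hB]
  exact mul_le_of_le_one_left (Real.sqrt_nonneg _) (Real.sqrt_le_one.mpr hA)

/-- The trace norm is attained by pairing with a contraction. -/
lemma exists_contraction_trace_mul_eq (X : Matrix d d ℂ) :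
    ∃ W : Matrix d d ℂ, (1 - W * Wᴴ).PosSemidef ∧ (W * X).trace = traceNorm X := by
  have hP := Matrix.posSemidef_conjTranspose_mul_self X
  set hH := hP.1
  set U : Matrix d d ℂ := hH.eigenvectorUnitary.1 with hU
  have hUU : U * Uᴴ = 1 := Unitary.coe_mul_star_self hH.eigenvectorUnitary
  have hD := conjTranspose_eigenvectorUnitary_mul_mul hH
  rw [← hU] at hD
  set s : d → ℝ := fun i => Real.sqrt (hH.eigenvalues i)
  have hs : ∀ i, (hH.eigenvalues i : ℂ) = s i * s i := fun i => by
    rw [← Complex.ofReal_mul, Real.mul_self_sqrt (hP.eigenvalues_nonneg i)]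
  set D : Matrix d d ℂ := diagonal fun i => ((s i)⁻¹ : ℂ)
  have hDstar : Dᴴ = D := by
    simp only [D, diagonal_conjTranspose]
    congr 1
    ext i
    simp
  refine ⟨U * D * Uᴴ * Xᴴ, ?_, ?_⟩
  · have h1 : 1 - (U * D * Uᴴ * Xᴴ) * (U * D * Uᴴ * Xᴴ)ᴴ =
        U * (1 - D * (Uᴴ * (Xᴴ * X) * U) * D) * Uᴴ := by
      simp only [conjTranspose_mul, conjTranspose_conjTranspose, Matrix.mul_sub, Matrix.sub_mul,
        Matrix.mul_one, hUU, hDstar, Matrix.mul_assoc]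
    rw [h1, hD]
    refine PosSemidef.mul_mul_conjTranspose_same ?_ U
    rw [diagonal_mul_diagonal, diagonal_mul_diagonal, ← diagonal_one, diagonal_sub]
    refine PosSemidef.diagonal fun i => ?_
    rw [hs]
    by_cases h : s i = 0
    · simp [h]
    · have h' : (s i : ℂ) ≠ 0 := by exact_mod_cast h
      have : (s i : ℂ)⁻¹ * (s i * s i) * (s i : ℂ)⁻¹ = 1 := by field_simp
      simp [this]
  · have h1 : (U * D * Uᴴ * Xᴴ * X).trace = (D * (Uᴴ * (Xᴴ * X) * U)).trace := by
      rw [show U * D * Uᴴ * Xᴴ * X = U * (D * (Uᴴ * (Xᴴ * X))) by simp only [Matrix.mul_assoc],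
        Matrix.trace_mul_comm]
      simp only [Matrix.mul_assoc]
    rw [h1, hD, diagonal_mul_diagonal, trace_diagonal, traceNorm, Complex.ofReal_sum]
    refine Finset.sum_congr rfl fun i _ => ?_
    change _ = (s i : ℂ)
    rw [hs]
    by_cases h : s i = 0
    · simp [h]
    · have h' : (s i : ℂ) ≠ 0 := by exact_mod_cast h
      field_simp

lemma traceNorm_le_of_forall {X : Matrix d d ℂ} {t : ℝ}
    (h : ∀ W : Matrix d d ℂ, (1 - W * Wᴴ).PosSemidef → ‖(W * X).trace‖ ≤ t) :
    traceNorm X ≤ t := by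
  obtain ⟨W, hW, hWX⟩ := exists_contraction_trace_mul_eq X
  have := h W hW
  rw [hWX, Complex.norm_real] at this
  exact (le_abs_self _).trans this

lemma traceNorm_nonneg (X : Matrix d d ℂ) : 0 ≤ traceNorm X :=
  Finset.sum_nonneg fun _ _ => Real.sqrt_nonneg _

lemma traceNorm_add_le (X Y : Matrix d d ℂ) :
    traceNorm (X + Y) ≤ traceNorm X + traceNorm Y := by
  refine traceNorm_le_of_forall fun W hW => ?_
  rw [Matrix.mul_add, trace_add]
  exact (norm_add_le _ _).trans
    (add_le_add (norm_trace_mul_le_traceNorm X hW) (norm_trace_mul_le_traceNorm Y hW))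

lemma traceNorm_smul_le (r : ℂ) (X : Matrix d d ℂ) :
    traceNorm (r • X) ≤ ‖r‖ * traceNorm X := by
  refine traceNorm_le_of_forall fun W hW => ?_
  rw [Matrix.mul_smul, trace_smul, norm_smul]
  exact mul_le_mul_of_nonneg_left (norm_trace_mul_le_traceNorm X hW) (norm_nonneg r)

lemma traceNorm_conj_le {U : Matrix d d ℂ} (hU : Uᴴ * U = 1) (X : Matrix d d ℂ) :
    traceNorm (U * X * Uᴴ) ≤ traceNorm X := by
  have hU' : U * Uᴴ = 1 := mul_eq_one_comm.mp hU
  refine traceNorm_le_of_forall fun W hW => ?_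
  have h1 : (W * (U * X * Uᴴ)).trace = ((Uᴴ * W * U) * X).trace := by
    rw [← Matrix.mul_assoc, Matrix.trace_mul_comm]
    simp only [Matrix.mul_assoc]
  rw [h1]
  refine norm_trace_mul_le_traceNorm X ?_
  have h2 : 1 - (Uᴴ * W * U) * (Uᴴ * W * U)ᴴ = Uᴴ * (1 - W * Wᴴ) * U := by
    have h3 : ∀ M : Matrix d d ℂ, U * (Uᴴ * M) = M := fun M => by
      rw [← Matrix.mul_assoc, hU', Matrix.one_mul]
    simp only [conjTranspose_mul, conjTranspose_conjTranspose, Matrix.mul_sub, Matrix.sub_mul,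
      Matrix.mul_one, hU, Matrix.mul_assoc, h3]
  rw [h2]
  exact hW.conjTranspose_mul_mul_same U

lemma traceNorm_submatrix_le (σ : d ≃ d) (X : Matrix d d ℂ) :
    traceNorm (X.submatrix σ σ) ≤ traceNorm X := by
  refine traceNorm_le_of_forall fun W hW => ?_
  have h1 : (W * X.submatrix σ σ).trace = (W.submatrix σ.symm σ.symm * X).trace := by
    have h : W * X.submatrix σ σ = (W.submatrix σ.symm σ.symm * X).submatrix σ σ := by
      rw [← submatrix_mul_equiv _ _ σ σ σ]
      simp
    rw [h]
    exact Equiv.sum_comp σ fun i => (W.submatrix σ.symm σ.symm * X) i i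
  rw [h1]
  refine norm_trace_mul_le_traceNorm X ?_
  have h2 : 1 - W.submatrix σ.symm σ.symm * (W.submatrix σ.symm σ.symm)ᴴ =
      (1 - W * Wᴴ).submatrix σ.symm σ.symm := by
    rw [conjTranspose_submatrix, submatrix_mul_equiv, submatrix_sub]
    simp
  rw [h2]
  exact hW.submatrix _

end TraceNorm

section Pinching

variable {α : Type*} [Fintype α] [DecidableEq α]

/-- Conjugation by the diagonal matrix whose entry at `(i, k)` is `z ^ k`. -/
def phaseConj (z : ℂ) (X : Matrix (α × Fin 3) (α × Fin 3) ℂ) :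
    Matrix (α × Fin 3) (α × Fin 3) ℂ :=
  diagonal (fun p : α × Fin 3 => z ^ (p.2 : ℕ)) * X *
    (diagonal fun p : α × Fin 3 => z ^ (p.2 : ℕ))ᴴ

lemma phaseConj_apply (z : ℂ) (X : Matrix (α × Fin 3) (α × Fin 3) ℂ) (p q : α × Fin 3) :
    phaseConj z X p q = z ^ (p.2 : ℕ) * X p q * star z ^ (q.2 : ℕ) := by
  simp [phaseConj, diagonal_conjTranspose, mul_diagonal, diagonal_mul]

lemma traceNorm_phaseConj_le {z : ℂ} (hz : star z * z = 1)
    (X : Matrix (α × Fin 3) (α × Fin 3) ℂ) : traceNorm (phaseConj z X) ≤ traceNorm X := by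
  refine traceNorm_conj_le ?_ X
  rw [diagonal_conjTranspose, diagonal_mul_diagonal, ← diagonal_one]
  congr 1
  ext p
  rw [Pi.star_apply, star_pow, ← mul_pow, hz, one_pow]

/-- The pinching of `X` onto the blocks that are diagonal in the second tensor factor. -/
def pinch (X : Matrix (α × Fin 3) (α × Fin 3) ℂ) : Matrix (α × Fin 3) (α × Fin 3) ℂ :=
  of fun p q => if p.2 = q.2 then X p q else 0

lemma exists_cube_root : ∃ ω : ℂ, 1 + ω + ω ^ 2 = 0 ∧ star ω = ω ^ 2 := by
  have h3 : Real.sqrt 3 * Real.sqrt 3 = 3 := Real.mul_self_sqrt (by norm_num)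
  refine ⟨⟨-1 / 2, Real.sqrt 3 / 2⟩, ?_, ?_⟩ <;> apply Complex.ext <;>
    simp [pow_two] <;> linarith

lemma smul_pinch_sub_eq {ω : ℂ} (h : 1 + ω + ω ^ 2 = 0) (hs : star ω = ω ^ 2)
    (X : Matrix (α × Fin 3) (α × Fin 3) ℂ) :
    (3 : ℂ) • pinch X - X = phaseConj ω X + phaseConj (ω ^ 2) X := by
  have hc : ω ^ 3 = 1 := by linear_combination (ω - 1) * h
  have hs2 : star (ω ^ 2) = ω := by rw [star_pow, hs]; linear_combination ω * hc
  ext ⟨i, k⟩ ⟨j, l⟩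
  simp only [Matrix.sub_apply, Matrix.add_apply, Matrix.smul_apply, phaseConj_apply, hs, hs2,
    pinch, of_apply, smul_eq_mul]
  generalize X (i, k) (j, l) = x
  fin_cases k <;> fin_cases l <;> simp <;> grind

lemma traceNorm_smul_pinch_sub_le (X : Matrix (α × Fin 3) (α × Fin 3) ℂ) :
    traceNorm ((3 : ℂ) • pinch X - X) ≤ 2 * traceNorm X := by
  obtain ⟨ω, h, hs⟩ := exists_cube_root
  have hc : ω ^ 3 = 1 := by linear_combination (ω - 1) * h
  have h1 : star ω * ω = 1 := by rw [hs]; linear_combination hc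
  have h2 : star (ω ^ 2) * ω ^ 2 = 1 := by rw [star_pow, ← mul_pow, h1, one_pow]
  rw [smul_pinch_sub_eq h hs, two_mul]
  exact (traceNorm_add_le _ _).trans
    (add_le_add (traceNorm_phaseConj_le h1 X) (traceNorm_phaseConj_le h2 X))

lemma traceNorm_pinch_le (X : Matrix (α × Fin 3) (α × Fin 3) ℂ) :
    traceNorm (pinch X) ≤ traceNorm X := by
  have h : pinch X = (1 / 3 : ℂ) • (((3 : ℂ) • pinch X - X) + X) := by
    rw [sub_add_cancel, smul_smul]
    norm_num
  have h1 := traceNorm_smul_le (1 / 3 : ℂ) (((3 : ℂ) • pinch X - X) + X)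
  rw [← h] at h1
  have h2 := traceNorm_add_le ((3 : ℂ) • pinch X - X) X
  have h3 := traceNorm_smul_pinch_sub_le X
  rw [show ‖(1 / 3 : ℂ)‖ = 1 / 3 by norm_num] at h1
  linarith

/-- The cyclic shift by `s` of the second tensor factor. -/
def shiftEquiv (s : Fin 3) : α × Fin 3 ≃ α × Fin 3 :=
  (Equiv.refl α).prodCongr (Equiv.addRight s)

end Pinching

lemma idTensor_PhiG_eq (b c : ℝ) (X : Matrix (Fin 3 × Fin 3) (Fin 3 × Fin 3) ℂ) :
    idTensor (PhiG c b) X =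
      ((-((b + c) / 6) : ℝ) : ℂ) • X + (((3 - b - c) / 6 : ℝ) : ℂ) • ((3 : ℂ) • pinch X - X) +
        ((c / 2 : ℝ) : ℂ) • (pinch X).submatrix (shiftEquiv 1) (shiftEquiv 1) +
        ((b / 2 : ℝ) : ℂ) • (pinch X).submatrix (shiftEquiv 2) (shiftEquiv 2) := by
  ext ⟨i, k⟩ ⟨j, l⟩
  fin_cases k <;> fin_cases l <;>
    simp [idTensor, PhiG, pinch, shiftEquiv] <;> ring

/-- The diamond norm of `Φ_{b,c}† = Φ_{c,b}` is at most `(3 + b + c)/3` when `b, c ≥ 0`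
and `b + c ≤ 3`. -/
theorem diamond_norm_PhiGdual_le (b c : ℝ) (hb : 0 ≤ b) (hc : 0 ≤ c) (hbc : b + c ≤ 3)
    (X : Matrix (Fin 3 × Fin 3) (Fin 3 × Fin 3) ℂ) (hX : traceNorm X ≤ 1) :
    traceNorm (idTensor (PhiG c b) X) ≤ (3 + b + c) / 3 := by
  have key : ∀ (r t : ℝ) (Y : Matrix (Fin 3 × Fin 3) (Fin 3 × Fin 3) ℂ), traceNorm Y ≤ t →
      traceNorm ((r : ℂ) • Y) ≤ |r| * t := fun r t Y hY => by
    refine (traceNorm_smul_le _ _).trans ?_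
    rw [Complex.norm_real, Real.norm_eq_abs]
    exact mul_le_mul_of_nonneg_left hY (abs_nonneg r)
  have hP : traceNorm (pinch X) ≤ 1 := (traceNorm_pinch_le X).trans hX
  have h1 := key (-((b + c) / 6)) 1 X hX
  have h2 := key ((3 - b - c) / 6) 2 _ ((traceNorm_smul_pinch_sub_le X).trans (by linarith))
  have h3 := key (c / 2) 1 _ ((traceNorm_submatrix_le (shiftEquiv 1) _).trans hP)
  have h4 := key (b / 2) 1 _ ((traceNorm_submatrix_le (shiftEquiv 2) _).trans hP)
  rw [abs_neg, abs_of_nonneg (by linarith)] at h1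
  rw [abs_of_nonneg (by linarith)] at h2 h3 h4
  rw [idTensor_PhiG_eq]
  refine (traceNorm_add_le _ _).trans ((add_le_add ((traceNorm_add_le _ _).trans
    (add_le_add ((traceNorm_add_le _ _).trans (add_le_add h1 h2)) h3)) h4).trans ?_)
  linarith

end
end
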